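/- In the mixed even p-spin short-range model (every hyperedge has an even number of vertices), for every t ≥ 0, every 0 ≤ β < ∞, every r ∈ ℕ, and for both the continuous and the discrete perturbation, E⟨R(σ,τ)²⟩_t ≤ (1/N)·max_{i∈[N]} |B_r(i)| + e^{−tr}. -/

import Mathlib

open MeasureTheory ProbabilityTheory Real Finset

noncomputable section

/-! ### Basic objects: spins, Hermite polynomials, Gaussian measures -/

/-- The `±1` spin value attached to a Boolean. -/
def spin (b : Bool) : ℝ := if b then 1 else -1

/-- Normalized Hermite polynomial `h_m = He_m / √(m!)`,
orthonormal w.r.t. the standard Gaussian measure. -/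
def hermiteFn (m : ℕ) (x : ℝ) : ℝ :=
  Polynomial.aeval x (Polynomial.hermite m) / Real.sqrt (Nat.factorial m)

/-- The law of a family of i.i.d. standard Gaussians over a finite index set. -/
def gaussianPi (ι : Type*) [Fintype ι] : Measure (ι → ℝ) :=
  Measure.pi fun _ => gaussianReal 0 1

instance (ι : Type*) [Fintype ι] : IsProbabilityMeasure (gaussianPi ι) := by
  unfold gaussianPi; infer_instance

/-- Tensorized normalized Hermite polynomial `h_n(x) = ∏_e h_{n_e}(x_e)`. -/
def hermiteProd {ι : Type*} [Fintype ι] (n : ι → ℕ) (x : ι → ℝ) : ℝ :=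
  ∏ e, hermiteFn (n e) (x e)

/-- Continuous perturbation `J(t) = e^{-t} J + √(1-e^{-2t}) J'` of the disorder. -/
def contPerturb {ι : Type*} (t : ℝ) (J J' : ι → ℝ) : ι → ℝ := fun e =>
  Real.exp (-t) * J e + Real.sqrt (1 - Real.exp (-2 * t)) * J' e

/-- Discrete perturbation `J(t)_e = B_e J_e + (1-B_e) J'_e` of the disorder. -/
def discPerturb {ι : Type*} (J J' : ι → ℝ) (B : ι → Bool) : ι → ℝ := fun e =>
  if B e then J e else J' e

/-- Bernoulli measure on `Bool` with success probability `p`. -/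
def berBool (p : ℝ) : Measure Bool :=
  ENNReal.ofReal p • Measure.dirac true + ENNReal.ofReal (1 - p) • Measure.dirac false

instance (p : ℝ) : IsFiniteMeasure (berBool p) := by
  constructor
  simp only [berBool, Measure.coe_add, Pi.add_apply, Measure.smul_apply, smul_eq_mul,
    Measure.dirac_apply' _ MeasurableSet.univ, Set.indicator_univ, Pi.one_apply, mul_one]
  exact ENNReal.add_lt_top.mpr ⟨ENNReal.ofReal_lt_top, ENNReal.ofReal_lt_top⟩

/-- Product Gaussian measure for a pair `(J, J')` of independent disorders. -/
def pairGauss (ι : Type*) [Fintype ι] : Measure ((ι → ℝ) × (ι → ℝ)) :=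
  (gaussianPi ι).prod (gaussianPi ι)

/-- Product Gaussian measure for a triple of independent disorders. -/
def tripleGauss (ι : Type*) [Fintype ι] : Measure ((ι → ℝ) × (ι → ℝ) × (ι → ℝ)) :=
  (gaussianPi ι).prod ((gaussianPi ι).prod (gaussianPi ι))

/-- Law of `(J, J', B)`: two independent Gaussian disorders together with i.i.d.
Bernoulli(`p`) variables. -/
def tripleGaussBer (ι : Type*) [Fintype ι] (p : ℝ) :
    Measure ((ι → ℝ) × (ι → ℝ) × (ι → Bool)) :=
  (gaussianPi ι).prod ((gaussianPi ι).prod (Measure.pi fun _ => berBool p))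

/-! ### Spin models on hypergraphs -/

variable {N : ℕ}

/-- `σ_e = ∏_{v ∈ e} σ_v`. -/
def sigEdge (σ : Fin N → Bool) (e : Finset (Fin N)) : ℝ := ∏ v ∈ e, spin (σ v)

/-- Hamiltonian `H_J(σ) = Σ_e ρ_{|e|}(J_e) σ_e` of the short-range model. -/
def ham (Edges : Finset (Finset (Fin N))) (ρ : ℕ → ℝ → ℝ)
    (J : Finset (Fin N) → ℝ) (σ : Fin N → Bool) : ℝ :=
  ∑ e ∈ Edges, ρ e.card (J e) * sigEdge σ e

/-- Gibbs average of an observable `f` for the Hamiltonian `H` at inverse temperature `β`. -/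
def gibbs (β : ℝ) (H : (Fin N → Bool) → ℝ) (f : (Fin N → Bool) → ℝ) : ℝ :=
  (∑ σ : Fin N → Bool, f σ * Real.exp (β * H σ)) / ∑ σ : Fin N → Bool, Real.exp (β * H σ)

/-- Gibbs average of a two-replica observable `f(σ,τ)` where `σ, τ` are sampled from the
product of the Gibbs measures of the Hamiltonians `H₁`, `H₂`. -/
def gibbs2 (β : ℝ) (H₁ H₂ : (Fin N → Bool) → ℝ)
    (f : (Fin N → Bool) → (Fin N → Bool) → ℝ) : ℝ :=
  (∑ σ : Fin N → Bool, ∑ τ : Fin N → Bool, f σ τ * Real.exp (β * H₁ σ + β * H₂ τ)) /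
    ∑ σ : Fin N → Bool, ∑ τ : Fin N → Bool, Real.exp (β * H₁ σ + β * H₂ τ)

/-- Site overlap `R(σ,τ) = N⁻¹ Σ_i σ_i τ_i`. -/
def overlap (σ τ : Fin N → Bool) : ℝ := (∑ i, spin (σ i) * spin (τ i)) / N

/-- Fourier–Hermite coefficient `φ̂_{ij}(n) = E[⟨σ_i σ_j⟩ h_n(J)]` of the two-point
correlation function. -/
def twoPointCoeff (Edges : Finset (Finset (Fin N))) (ρ : ℕ → ℝ → ℝ) (β : ℝ)
    (i j : Fin N) (n : Finset (Fin N) → ℕ) : ℝ :=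
  ∫ ω, gibbs β (ham Edges ρ ω) (fun σ => spin (σ i) * spin (σ j)) * hermiteProd n ω
    ∂gaussianPi (Finset (Fin N))

/-- `E(n) = {e : n_e > 0}`. -/
def Esupp (n : Finset (Fin N) → ℕ) : Finset (Finset (Fin N)) :=
  Finset.univ.filter fun e => n e ≠ 0

/-- `V(n)`: the vertices covered by `E(n)`. -/
def Vsupp (n : Finset (Fin N) → ℕ) : Finset (Fin N) :=
  (Esupp n).biUnion id

/-- Disorder-averaged two-replica observable under the continuous perturbation:
`E ⟨f(σ,τ)⟩_t` with `σ ~ G_J`, `τ ~ G_{J(t)}`. -/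
def contExp (Edges : Finset (Finset (Fin N))) (ρ : ℕ → ℝ → ℝ) (β t : ℝ)
    (f : (Fin N → Bool) → (Fin N → Bool) → ℝ) : ℝ :=
  ∫ ω : (Finset (Fin N) → ℝ) × (Finset (Fin N) → ℝ),
    gibbs2 β (ham Edges ρ ω.1) (ham Edges ρ (contPerturb t ω.1 ω.2)) f
    ∂pairGauss (Finset (Fin N))

/-- Disorder-averaged two-replica observable under the discrete perturbation. -/
def discExp (Edges : Finset (Finset (Fin N))) (ρ : ℕ → ℝ → ℝ) (β t : ℝ)
    (f : (Fin N → Bool) → (Fin N → Bool) → ℝ) : ℝ :=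
  ∫ ω : (Finset (Fin N) → ℝ) × (Finset (Fin N) → ℝ) × (Finset (Fin N) → Bool),
    gibbs2 β (ham Edges ρ ω.1) (ham Edges ρ (discPerturb ω.1 ω.2.1 ω.2.2)) f
    ∂tripleGaussBer (Finset (Fin N)) (Real.exp (-t))

/-! ### Berge paths, distance, balls, cycles -/

/-- `(vs, es)` is a Berge path of length `ℓ` from `v` to `w` in the hypergraph `Edges`. -/
def IsBergePath (Edges : Finset (Finset (Fin N))) (ℓ : ℕ)
    (vs : Fin (ℓ + 1) → Fin N) (es : Fin ℓ → Finset (Fin N)) (v w : Fin N) : Prop :=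
  Function.Injective vs ∧ Function.Injective es ∧ (∀ k, es k ∈ Edges) ∧
    vs 0 = v ∧ vs (Fin.last ℓ) = w ∧
    ∀ k : Fin ℓ, vs k.castSucc ∈ es k ∧ vs k.succ ∈ es k

/-- Hypergraph (Berge) distance between two vertices, `∞` if there is no path. -/
def hdist (Edges : Finset (Finset (Fin N))) (v w : Fin N) : ℕ∞ :=
  sInf {d : ℕ∞ | ∃ (ℓ : ℕ) (vs : Fin (ℓ + 1) → Fin N) (es : Fin ℓ → Finset (Fin N)),
    IsBergePath Edges ℓ vs es v w ∧ d = (ℓ : ℕ∞)}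

open scoped Classical in
/-- The closed ball `B_r(v)` in the hypergraph distance. -/
def hball (Edges : Finset (Finset (Fin N))) (v : Fin N) (r : ℕ) : Finset (Fin N) :=
  Finset.univ.filter fun w => hdist Edges v w ≤ (r : ℕ∞)

/-- The hypergraph `Edges` contains a Berge cycle. -/
def HasBergeCycle (Edges : Finset (Finset (Fin N))) : Prop :=
  ∃ (ℓ : ℕ) (vs : Fin ℓ → Fin N) (es : Fin ℓ → Finset (Fin N)),
    2 ≤ ℓ ∧ Function.Injective vs ∧ Function.Injective es ∧ (∀ k, es k ∈ Edges) ∧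
      ∀ k : Fin ℓ, vs k ∈ es k ∧ vs (finRotate ℓ k) ∈ es k

/-- `min(d, c)` where `d ∈ ℕ∞` and `c ∈ ℝ` (equal to `c` if `d = ∞`). -/
def truncMin (d : ℕ∞) (c : ℝ) : ℝ :=
  if d = ⊤ then c else min (d.toNat : ℝ) c

/-! ### The diluted mixed p-spin random hypergraph -/

/-- Probability that a given hyperedge is present in the diluted model. -/
def edgeProb (α : ℕ → ℝ) (Δ N : ℕ) (e : Finset (Fin N)) : ℝ :=
  if 2 ≤ e.card ∧ e.card ≤ Δ then α e.card * N / (N.choose e.card) else 0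

/-- The law of the diluted mixed `p`-spin random hypergraph: each hyperedge `e` with
`2 ≤ |e| ≤ Δ` is present independently with probability `α_{|e|} N / C(N,|e|)`. -/
def graphMeasure (α : ℕ → ℝ) (Δ N : ℕ) : Measure (Finset (Fin N) → Bool) :=
  Measure.pi fun e => berBool (edgeProb α Δ N e)

/-- The (random) hyperedge set determined by the indicator `g`. -/
def edgesOf {N : ℕ} (Δ : ℕ) (g : Finset (Fin N) → Bool) : Finset (Finset (Fin N)) :=
  Finset.univ.filter fun e => g e = true ∧ 2 ≤ e.card ∧ e.card ≤ Δ

/-- `λ = Σ_p p(p-1) α_p`. -/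
def lamMix (α : ℕ → ℝ) (Δ : ℕ) : ℝ :=
  ∑ p ∈ Finset.Icc 2 Δ, (p : ℝ) * ((p : ℝ) - 1) * α p

/-- `λ' = Σ_p p(p-1)(p-2) α_p`. -/
def lamMix' (α : ℕ → ℝ) (Δ : ℕ) : ℝ :=
  ∑ p ∈ Finset.Icc 2 Δ, (p : ℝ) * ((p : ℝ) - 1) * ((p : ℝ) - 2) * α p

/-- The exploration (breadth-first search) process `(R_t, I_t, S_t, E_t)` of a hypergraph
started at the vertex `i`. -/
def explore {N : ℕ} (Edges : Finset (Finset (Fin N))) (i : Fin N) :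
    ℕ → Finset (Fin N) × Finset (Fin N) × Finset (Fin N) × Finset (Finset (Fin N))
  | 0 => (∅, {i}, Finset.univ.erase i, ∅)
  | t + 1 =>
      let P := explore Edges i t
      let Enew := Edges.filter fun e => (e ∩ P.2.1).Nonempty ∧ e ∩ P.1 = ∅
      (P.1 ∪ P.2.1, Enew.biUnion fun e => e ∩ P.2.2.1,
        P.2.2.1 \ Enew.biUnion fun e => e ∩ P.2.2.1, Enew)

/-- The set `I_t` of newly explored vertices at step `t`. -/
def Iset {N : ℕ} (Edges : Finset (Finset (Fin N))) (i : Fin N) (t : ℕ) : Finset (Fin N) :=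
  (explore Edges i t).2.1

/-- Disorder-and-graph-averaged two-replica observable under the continuous perturbation
in the diluted model. -/
def dilContExp (α : ℕ → ℝ) (Δ N : ℕ) (ρ : ℕ → ℝ → ℝ) (β t : ℝ)
    (f : (Fin N → Bool) → (Fin N → Bool) → ℝ) : ℝ :=
  ∫ ω : (Finset (Fin N) → Bool) × (Finset (Fin N) → ℝ) × (Finset (Fin N) → ℝ),
    gibbs2 β (ham (edgesOf Δ ω.1) ρ ω.2.1)
      (ham (edgesOf Δ ω.1) ρ (contPerturb t ω.2.1 ω.2.2)) f
    ∂((graphMeasure α Δ N).prod (pairGauss (Finset (Fin N))))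

/-- Disorder-and-graph-averaged two-replica observable under the discrete perturbation
in the diluted model. -/
def dilDiscExp (α : ℕ → ℝ) (Δ N : ℕ) (ρ : ℕ → ℝ → ℝ) (β t : ℝ)
    (f : (Fin N → Bool) → (Fin N → Bool) → ℝ) : ℝ :=
  ∫ ω : (Finset (Fin N) → Bool) ×
      (Finset (Fin N) → ℝ) × (Finset (Fin N) → ℝ) × (Finset (Fin N) → Bool),
    gibbs2 β (ham (edgesOf Δ ω.1) ρ ω.2.1)
      (ham (edgesOf Δ ω.1) ρ (discPerturb ω.2.1 ω.2.2.1 ω.2.2.2)) f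
    ∂((graphMeasure α Δ N).prod (tripleGaussBer (Finset (Fin N)) (Real.exp (-t))))

/-! ### The Lévy model -/

/-- Hamiltonian of the Lévy model: `H(σ) = a_N⁻¹ Σ_{i,j} ρ(J_{ij}) σ_i σ_j`. -/
def levyHam (N : ℕ) (aN : ℝ) (ρ : ℝ → ℝ) (J : Fin N × Fin N → ℝ) (σ : Fin N → Bool) : ℝ :=
  (∑ p : Fin N × Fin N, ρ (J p) * (spin (σ p.1) * spin (σ p.2))) / aN

/-- The normalization `a_N = inf{x > 0 : P(|ρ(J)| > x) ≤ 1/N}`. -/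
def levyAN (ρ : ℝ → ℝ) (N : ℕ) : ℝ :=
  sInf {x : ℝ | 0 < x ∧ ((gaussianReal 0 1) {j | x < |ρ j|}).toReal ≤ 1 / N}

/-- The coupled free energy `F_N(t,λ)` of the Lévy model, with the two systems
perturbed by the Ornstein–Uhlenbeck flow at time `t`. -/
def levyF (N : ℕ) (β aN lam : ℝ) (ρ : ℝ → ℝ) (t : ℝ) : ℝ :=
  (∫ ω : (Fin N × Fin N → ℝ) × (Fin N × Fin N → ℝ) × (Fin N × Fin N → ℝ),
      Real.log (∑ σ : Fin N → Bool, ∑ τ : Fin N → Bool,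
        Real.exp (β * levyHam N aN ρ (fun p => Real.exp (-t / 2) * ω.1 p +
              Real.sqrt (1 - Real.exp (-t)) * ω.2.1 p) σ +
          β * levyHam N aN ρ (fun p => Real.exp (-t / 2) * ω.1 p +
              Real.sqrt (1 - Real.exp (-t)) * ω.2.2 p) τ +
          lam * N * overlap σ τ ^ 2))
    ∂tripleGauss (Fin N × Fin N)) / N

/-- The coupled free energy `F_N(∞,λ)`: the two systems carry independent disorders. -/
def levyFinf (N : ℕ) (β aN lam : ℝ) (ρ : ℝ → ℝ) : ℝ :=
  (∫ ω : (Fin N × Fin N → ℝ) × (Fin N × Fin N → ℝ) × (Fin N × Fin N → ℝ),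
      Real.log (∑ σ : Fin N → Bool, ∑ τ : Fin N → Bool,
        Real.exp (β * levyHam N aN ρ ω.2.1 σ + β * levyHam N aN ρ ω.2.2 τ +
          lam * N * overlap σ τ ^ 2))
    ∂tripleGauss (Fin N × Fin N)) / N

/-- `φ(t) = Σ_r E[L_r(J¹(t)) L_r(J²(t))]` where `J^i(t) = e^{-t/2} J + √(1-e^{-t}) J^i`. -/
def phiFn (k m : ℕ) (L : Fin m → (Fin k → ℝ) → ℝ) (t : ℝ) : ℝ :=
  ∑ r : Fin m, ∫ ω : (Fin k → ℝ) × (Fin k → ℝ) × (Fin k → ℝ),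
    L r (fun l => Real.exp (-t / 2) * ω.1 l + Real.sqrt (1 - Real.exp (-t)) * ω.2.1 l) *
      L r (fun l => Real.exp (-t / 2) * ω.1 l + Real.sqrt (1 - Real.exp (-t)) * ω.2.2 l)
    ∂tripleGauss (Fin k)

/-- The graph joining two distinct vertices whenever they lie in a common hyperedge of `S`. -/
def cliqueGraph (S : Finset (Finset (Fin N))) : SimpleGraph (Fin N) where
  Adj u w := u ≠ w ∧ ∃ e ∈ S, u ∈ e ∧ w ∈ e
  symm := ⟨fun _ _ ⟨h, e, he, hu, hw⟩ => ⟨h.symm, e, he, hw, hu⟩⟩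
  loopless := ⟨fun _ h => h.1 rfl⟩

lemma cliqueGraph_reachable_of_mem {S : Finset (Finset (Fin N))} {e : Finset (Fin N)} (he : e ∈ S)
    {u w : Fin N} (hu : u ∈ e) (hw : w ∈ e) : (cliqueGraph S).Reachable u w := by
  by_cases h : u = w
  · rw [h]
  · exact SimpleGraph.Adj.reachable (G := cliqueGraph S) ⟨h, e, he, hu, hw⟩

lemma cliqueGraph_dist_le_one {S : Finset (Finset (Fin N))} {e : Finset (Fin N)} (he : e ∈ S)
    {u w : Fin N} (hu : u ∈ e) (hw : w ∈ e) : (cliqueGraph S).dist u w ≤ 1 := by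
  by_cases h : u = w
  · rw [h]; simp
  · exact (SimpleGraph.dist_eq_one_iff_adj.2 (⟨h, e, he, hu, hw⟩ : (cliqueGraph S).Adj u w)).le

/-- Indices along a geodesic differ by at most the distance of the corresponding vertices. -/
lemma geodesic_le_add_dist {V : Type*} {G : SimpleGraph V} {u v : V} (p : G.Walk u v)
    (hp : p.length = G.dist u v) {a b : ℕ} (hb : b ≤ p.length) :
    b ≤ a + G.dist (p.getVert a) (p.getVert b) := by
  have h1 : G.dist u (p.getVert a) ≤ a := by
    refine (SimpleGraph.dist_le (p.take a)).trans ?_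
    simp [SimpleGraph.Walk.take_length]
  have h2 : G.dist (p.getVert b) v ≤ p.length - b := by
    refine (SimpleGraph.dist_le (p.drop b)).trans ?_
    simp [SimpleGraph.Walk.drop_length]
  have hab : G.Reachable (p.getVert a) (p.getVert b) :=
    ((p.take a).reachable.symm).trans (p.take b).reachable
  have h3 := (p.take a).reachable.dist_triangle_left v
  have h4 := hab.dist_triangle_left v
  omega

/-- Vertices connected through the hyperedges of `S` are at Berge distance at most `|S|`. -/
lemma hdist_le_card_of_reachable {Edges S : Finset (Finset (Fin N))} (hS : S ⊆ Edges)
    {i j : Fin N} (h : (cliqueGraph S).Reachable i j) : hdist Edges i j ≤ (S.card : ℕ∞) := by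
  obtain ⟨p, hp⟩ := h.exists_walk_length_eq_dist
  have hadj : ∀ k : Fin p.length,
      ∃ e ∈ S, p.getVert (k : ℕ) ∈ e ∧ p.getVert ((k : ℕ) + 1) ∈ e :=
    fun k => (p.adj_getVert_succ k.2).2
  choose es hesS hes using hadj
  have hinj : Function.Injective es := by
    have key : ∀ k k' : Fin p.length, es k = es k' → (k' : ℕ) ≤ k := by
      intro k k' hkk
      have h1 := cliqueGraph_dist_le_one (hesS k') (hkk ▸ (hes k).1) (hes k').2
      have h2 := geodesic_le_add_dist p hp (a := k) (b := k' + 1) k'.2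
      omega
    intro k k' hkk
    exact Fin.ext (le_antisymm (key k' k hkk.symm) (key k k' hkk))
  have hvs : Function.Injective fun k : Fin (p.length + 1) => p.getVert (k : ℕ) := by
    have key : ∀ k k' : Fin (p.length + 1), p.getVert (k : ℕ) = p.getVert (k' : ℕ) →
        (k' : ℕ) ≤ k := by
      intro k k' hkk
      have h2 := geodesic_le_add_dist p hp (a := k) (b := k')
        (Nat.lt_succ_iff.1 k'.2)
      rw [hkk, SimpleGraph.dist_self] at h2
      exact h2
    intro k k' hkk
    exact Fin.ext (le_antisymm (key k' k hkk.symm) (key k k' hkk))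
  have hlen : p.length ≤ S.card := by
    have := Finset.card_le_card_of_injOn (s := Finset.univ) (t := S) es
      (fun k _ => hesS k) hinj.injOn
    simpa using this
  have hle : hdist Edges i j ≤ (p.length : ℕ∞) := by
    refine sInf_le ⟨p.length, fun k => p.getVert k, es, ⟨hvs, hinj, fun k => hS (hesS k), ?_, ?_,
      fun k => ?_⟩, rfl⟩
    · simp
    · simp
    · simpa using hes k
  exact hle.trans (by exact_mod_cast hlen)

lemma spin_mul_self (b : Bool) : spin b * spin b = 1 := by cases b <;> simp [spin]

lemma abs_spin (b : Bool) : |spin b| = 1 := by cases b <;> simp [spin]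

lemma spin_beq (a b : Bool) : spin (a == b) = spin a * spin b := by
  cases a <;> cases b <;> simp [spin]

lemma sigEdge_beq (κ σ : Fin N → Bool) (e : Finset (Fin N)) :
    sigEdge (fun v => κ v == σ v) e = sigEdge κ e * sigEdge σ e := by
  simp only [sigEdge, spin_beq, Finset.prod_mul_distrib]

lemma sigEdge_eq_or (κ : Fin N → Bool) (e : Finset (Fin N)) :
    sigEdge κ e = 1 ∨ sigEdge κ e = -1 := by
  have : sigEdge κ e * sigEdge κ e = 1 := by
    simp only [sigEdge, ← Finset.prod_mul_distrib, spin_mul_self, Finset.prod_const_one]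
  exact mul_self_eq_one_iff.1 this

/-- The two-point function `⟨σ_i σ_j⟩` as a function of the disorder. -/
def corr (Edges : Finset (Finset (Fin N))) (ρ : ℕ → ℝ → ℝ) (β : ℝ) (i j : Fin N)
    (J : Finset (Fin N) → ℝ) : ℝ :=
  gibbs β (ham Edges ρ J) fun σ => spin (σ i) * spin (σ j)

/-- Gauge covariance: twisting the couplings by a spin configuration `κ` multiplies the two-point
function by `κ_i κ_j`. -/
lemma corr_gauge (Edges : Finset (Finset (Fin N))) (ρ : ℕ → ℝ → ℝ)
    (hρodd : ∀ p x, ρ p (-x) = - ρ p x) (β : ℝ) (i j : Fin N) (κ : Fin N → Bool)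
    (ε : Finset (Fin N) → ℝ) (hε : ∀ e ∈ Edges, ε e = sigEdge κ e) (J : Finset (Fin N) → ℝ) :
    corr Edges ρ β i j (fun e => ε e * J e) =
      spin (κ i) * spin (κ j) * corr Edges ρ β i j J := by
  have hham : ∀ σ : Fin N → Bool, ham Edges ρ (fun e => ε e * J e) σ =
      ham Edges ρ J (fun v => κ v == σ v) := by
    intro σ
    refine Finset.sum_congr rfl fun e he => ?_
    beta_reduce
    rw [sigEdge_beq, hε e he]
    rcases sigEdge_eq_or κ e with h | h <;> simp [h, hρodd]
  have hinv : Function.Involutive fun (σ : Fin N → Bool) v => κ v == σ v := by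
    intro σ
    funext v
    change (κ v == (κ v == σ v)) = σ v
    cases κ v <;> cases σ v <;> rfl
  let E : Equiv.Perm (Fin N → Bool) := hinv.toPerm
  unfold corr gibbs
  rw [mul_div_assoc', Finset.mul_sum]
  congr 1
  · rw [← Equiv.sum_comp E]
    refine Finset.sum_congr rfl fun σ _ => ?_
    rw [hham]
    have : (fun v => κ v == E σ v) = σ := hinv σ
    rw [this]
    change spin (κ i == σ i) * spin (κ j == σ j) * _ = _
    rw [spin_beq, spin_beq]
    ring
  · rw [← Equiv.sum_comp E]
    refine Finset.sum_congr rfl fun σ _ => ?_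
    rw [hham]
    have : (fun v => κ v == E σ v) = σ := hinv σ
    rw [this]

lemma abs_gibbs_le_one (β : ℝ) (H f : (Fin N → Bool) → ℝ) (hf : ∀ σ, |f σ| ≤ 1) :
    |gibbs β H f| ≤ 1 := by
  have hpos : 0 < ∑ σ : Fin N → Bool, Real.exp (β * H σ) :=
    Finset.sum_pos (fun _ _ => Real.exp_pos _) Finset.univ_nonempty
  rw [gibbs, abs_div, abs_of_pos hpos, div_le_one hpos]
  refine (Finset.abs_sum_le_sum_abs _ _).trans (Finset.sum_le_sum fun σ _ => ?_)
  rw [abs_mul, Real.abs_exp]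
  exact mul_le_of_le_one_left (Real.exp_pos _).le (hf σ)

lemma abs_corr_le_one (Edges : Finset (Finset (Fin N))) (ρ : ℕ → ℝ → ℝ) (β : ℝ) (i j : Fin N)
    (J : Finset (Fin N) → ℝ) : |corr Edges ρ β i j J| ≤ 1 :=
  abs_gibbs_le_one _ _ _ fun σ => by rw [abs_mul, abs_spin, abs_spin, one_mul]

lemma measurable_corr (Edges : Finset (Finset (Fin N))) {ρ : ℕ → ℝ → ℝ}
    (hρmeas : ∀ p, Measurable (ρ p)) (β : ℝ) (i j : Fin N) :
    Measurable (corr Edges ρ β i j) := by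
  have hham : ∀ σ, Measurable fun J : Finset (Fin N) → ℝ => ham Edges ρ J σ := fun σ =>
    Finset.measurable_fun_sum _ fun e _ =>
      ((hρmeas _).comp (measurable_pi_apply e)).mul_const _
  unfold corr gibbs
  refine Measurable.div ?_ ?_
  · exact Finset.measurable_fun_sum _ fun σ _ => (((hham σ).const_mul β).exp).const_mul _
  · exact Finset.measurable_fun_sum _ fun σ _ => ((hham σ).const_mul β).exp

/-- Sign flips of couplings outside any prescribed small set, reversing the sign of `φ`. -/
def OddOutside {ι : Type*} (r : ℕ) (φ : (ι → ℝ) → ℝ) : Prop :=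
  ∀ S : Finset ι, S.card ≤ r → ∃ ε : ι → ℝ, (∀ e, ε e = 1 ∨ ε e = -1) ∧ (∀ e ∈ S, ε e = 1) ∧
    ∀ x, φ (fun e => ε e * x e) = - φ x

lemma oddOutside_corr (Edges : Finset (Finset (Fin N))) (heven : ∀ e ∈ Edges, Even e.card)
    (ρ : ℕ → ℝ → ℝ) (hρodd : ∀ p x, ρ p (-x) = - ρ p x) (β : ℝ) (i j : Fin N) (r : ℕ)
    (hij : ¬ hdist Edges i j ≤ (r : ℕ∞)) : OddOutside r (corr Edges ρ β i j) := by
  classical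
  intro S hS
  set G := cliqueGraph (S ∩ Edges)
  set κ : Fin N → Bool := fun v => decide (G.Reachable i v)
  have hi : spin (κ i) = 1 := by simp [spin, κ]
  have hj : spin (κ j) = -1 := by
    have : ¬ G.Reachable i j := fun h => hij <|
      (hdist_le_card_of_reachable Finset.inter_subset_right h).trans <| by
        exact_mod_cast (Finset.card_le_card Finset.inter_subset_left).trans hS
    simp [spin, κ, this]
  have hκ : ∀ e ∈ S ∩ Edges, sigEdge κ e = 1 := by
    intro e he
    by_cases hv : ∃ v ∈ e, G.Reachable i v
    · obtain ⟨v, hv, hiv⟩ := hv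
      refine Finset.prod_eq_one fun w hw => ?_
      have : G.Reachable i w := hiv.trans (cliqueGraph_reachable_of_mem he hv hw)
      simp [spin, κ, this]
    · push Not at hv
      have : sigEdge κ e = ∏ v ∈ e, (-1 : ℝ) :=
        Finset.prod_congr rfl fun v h => by simp [spin, κ, hv v h]
      rw [this, Finset.prod_const, (heven e (Finset.mem_inter.1 he).2).neg_one_pow]
  refine ⟨fun e => if e ∈ Edges then sigEdge κ e else 1, fun e => ?_, fun e he => ?_, fun x => ?_⟩
  · dsimp only
    split_ifs
    · exact sigEdge_eq_or κ e
    · exact Or.inl rfl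
  · dsimp only
    split_ifs with h
    · exact hκ e (Finset.mem_inter.2 ⟨he, h⟩)
    · rfl
  · rw [corr_gauge Edges ρ hρodd β i j κ _ (fun e he => if_pos he), hi, hj]
    ring

lemma integrable_of_abs_le_one {Ω : Type*} [MeasurableSpace Ω] {P : Measure Ω} [IsFiniteMeasure P]
    {f : Ω → ℝ} (hf : Measurable f) (h : ∀ x, |f x| ≤ 1) : Integrable f P :=
  Integrable.of_bound hf.aestronglyMeasurable 1 (Filter.Eventually.of_forall h)

lemma abs_integral_le_one {Ω : Type*} [MeasurableSpace Ω] {P : Measure Ω} [IsProbabilityMeasure P]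
    {f : Ω → ℝ} (h : ∀ x, |f x| ≤ 1) : |∫ x, f x ∂P| ≤ 1 := by
  have := norm_integral_le_of_norm_le_const (μ := P) (f := f) (C := 1)
    (Filter.Eventually.of_forall h)
  simpa using this

lemma abs_mul_le_one {a b : ℝ} (ha : |a| ≤ 1) (hb : |b| ≤ 1) : |a * b| ≤ 1 := by
  rw [abs_mul]
  exact mul_le_one₀ ha (abs_nonneg _) hb

lemma sq_integral_le_integral_sq {Ω : Type*} [MeasurableSpace Ω] {P : Measure Ω}
    [IsProbabilityMeasure P] {f : Ω → ℝ} (hf : Measurable f) (h : ∀ x, |f x| ≤ 1) :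
    (∫ x, f x ∂P) ^ 2 ≤ ∫ x, f x ^ 2 ∂P := by
  have hL : MemLp f 2 P := MemLp.of_bound hf.aestronglyMeasurable 1 (Filter.Eventually.of_forall h)
  have h0 := variance_nonneg f P
  rw [variance_eq_sub hL] at h0
  simpa using h0

/-- If `F` is a noisy update of a random point of `X` such that two conditionally independent
updates are distributed as a point together with its update by `F'`, then the autocorrelation of a
bounded function along `F` is controlled by the one along `F'`. -/
lemma sq_autocorr_le {X Y Z : Type*} [MeasurableSpace X] [MeasurableSpace Y] [MeasurableSpace Z]
    (μ : Measure X) (ν : Measure Y) (ν' : Measure Z) [IsProbabilityMeasure μ]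
    [IsProbabilityMeasure ν] [IsProbabilityMeasure ν']
    {F : X × Y → X} {F' : X × Z → X} (hF : Measurable F) (hF' : Measurable F')
    (hlaw : (μ.prod (ν.prod ν)).map (fun p => (F (p.1, p.2.1), F (p.1, p.2.2))) =
      (μ.prod ν').map (fun p => (p.1, F' p)))
    {φ : X → ℝ} (hφ : Measurable φ) (hb : ∀ x, |φ x| ≤ 1) :
    (∫ p, φ p.1 * φ (F p) ∂μ.prod ν) ^ 2 ≤ ∫ p, φ p.1 * φ (F' p) ∂μ.prod ν' := by
  set g : X → ℝ := fun x => ∫ y, φ (F (x, y)) ∂ν with hg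
  have hgm : Measurable g :=
    (StronglyMeasurable.integral_prod_right (f := fun x y => φ (F (x, y)))
      (hφ.comp hF).stronglyMeasurable).measurable
  have hgb : ∀ x, |g x| ≤ 1 := fun x => abs_integral_le_one fun y => hb _
  have h1 : ∫ p, φ p.1 * φ (F p) ∂μ.prod ν = ∫ x, φ x * g x ∂μ := by
    rw [integral_prod _ (integrable_of_abs_le_one (by fun_prop)
      fun p => abs_mul_le_one (hb _) (hb _))]
    simp only [hg, integral_const_mul]
  have h2 : ∫ x, g x ^ 2 ∂μ = ∫ p, φ p.1 * φ (F' p) ∂μ.prod ν' := by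
    have hm : Measurable fun q : X × X => φ q.1 * φ q.2 := by fun_prop
    have e1 : ∫ p, φ p.1 * φ (F' p) ∂μ.prod ν' =
        ∫ q, φ q.1 * φ q.2 ∂(μ.prod ν').map (fun p => (p.1, F' p)) := by
      rw [integral_map (by fun_prop) hm.aestronglyMeasurable]
    rw [e1, ← hlaw, integral_map (by fun_prop) hm.aestronglyMeasurable,
      integral_prod _ (integrable_of_abs_le_one (by fun_prop)
        fun p => abs_mul_le_one (hb _) (hb _))]
    refine integral_congr_ae (Filter.Eventually.of_forall fun x => ?_)
    change g x ^ 2 = ∫ y : Y × Y, φ (F (x, y.1)) * φ (F (x, y.2)) ∂ν.prod ν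
    rw [integral_prod_mul (fun y => φ (F (x, y))) (fun y => φ (F (x, y))), sq]
  rw [h1, ← h2]
  refine (sq_integral_le_integral_sq (by fun_prop)
    fun x => abs_mul_le_one (hb _) (hgb _)).trans ?_
  refine integral_mono (integrable_of_abs_le_one (by fun_prop) fun x => ?_)
    (integrable_of_abs_le_one (by fun_prop) fun x => ?_) fun x => ?_
  · rw [abs_pow]; exact pow_le_one₀ (abs_nonneg _) (abs_mul_le_one (hb _) (hgb _))
  · rw [abs_pow]; exact pow_le_one₀ (abs_nonneg _) (hgb _)
  · change (φ x * g x) ^ 2 ≤ g x ^ 2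
    rw [mul_pow]
    exact mul_le_of_le_one_left (sq_nonneg _) ((sq_le_one_iff_abs_le_one _).2 (hb x))

/-- A function with `q(s)² ≤ q(2s)` that decays at rate `r` up to a constant decays at rate `r`
with constant `1`. -/
lemma le_exp_of_sq_le_double {q : ℝ → ℝ} {C r : ℝ}
    (hsq : ∀ s, 0 < s → q s ^ 2 ≤ q (2 * s))
    (hdec : ∀ s, 1 ≤ s → q s ≤ C * Real.exp (-(s * r))) {s : ℝ} (hs : 0 < s) :
    q s ≤ Real.exp (-(s * r)) := by
  by_contra! hlt
  have hpow : ∀ k : ℕ, q s ^ 2 ^ k ≤ q (2 ^ k * s) := by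
    intro k
    induction k with
    | zero => simp
    | succ k ih =>
      have h0 : 0 ≤ q s ^ 2 ^ k := pow_nonneg ((Real.exp_pos _).trans hlt).le _
      calc q s ^ 2 ^ (k + 1) = (q s ^ 2 ^ k) ^ 2 := by rw [pow_succ 2 k, pow_mul]
        _ ≤ q (2 ^ k * s) ^ 2 := pow_le_pow_left₀ h0 ih 2
        _ ≤ q (2 * (2 ^ k * s)) := hsq _ (by positivity)
        _ = q (2 ^ (k + 1) * s) := by rw [pow_succ]; ring_nf
  set x := q s / Real.exp (-(s * r)) with hx
  have hx1 : 1 < x := (one_lt_div (Real.exp_pos _)).2 hlt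
  obtain ⟨n, hn⟩ := pow_unbounded_of_one_lt C hx1
  obtain ⟨m, hm⟩ := exists_nat_gt (1 / s)
  have hlt2 : ∀ l : ℕ, l ≤ 2 ^ l := fun l => Nat.lt_two_pow_self.le
  set k := n + m
  have hk1 : 1 ≤ 2 ^ k * s := by
    have h1 : (m : ℝ) ≤ 2 ^ k := by
      exact_mod_cast (Nat.le_add_left m n).trans (hlt2 k)
    rw [div_lt_iff₀ hs] at hm
    nlinarith
  have hxk : x ^ 2 ^ k ≤ C := by
    rw [hx, div_pow, div_le_iff₀ (by positivity)]
    refine (hpow k).trans ((hdec _ hk1).trans_eq ?_)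
    rw [← Real.exp_nat_mul]
    congr 2
    push_cast
    ring
  have : x ^ n ≤ x ^ 2 ^ k :=
    pow_le_pow_right₀ hx1.le ((Nat.le_add_right n m).trans (hlt2 k))
  linarith

/-- A coordinatewise measure identity for noisy updates lifts to product measures. -/
lemma map_pi_update_eq {ι X Y Z : Type*} [Fintype ι] [MeasurableSpace X] [MeasurableSpace Y]
    [MeasurableSpace Z] (μ : Measure X) (ν : Measure Y) (ν' : Measure Z) [IsProbabilityMeasure μ]
    [IsProbabilityMeasure ν] [IsProbabilityMeasure ν']
    {f : X × Y → X} {f' : X × Z → X} (hf : Measurable f) (hf' : Measurable f')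
    (hlaw : (μ.prod (ν.prod ν)).map (fun p => (f (p.1, p.2.1), f (p.1, p.2.2))) =
      (μ.prod ν').map (fun p => (p.1, f' p))) :
    ((Measure.pi fun _ : ι => μ).prod
      ((Measure.pi fun _ : ι => ν).prod (Measure.pi fun _ : ι => ν))).map
        (fun p => ((fun e => f (p.1 e, p.2.1 e)), (fun e => f (p.1 e, p.2.2 e)))) =
      ((Measure.pi fun _ : ι => μ).prod (Measure.pi fun _ : ι => ν')).map
        (fun p => (p.1, fun e => f' (p.1 e, p.2 e))) := by
  have E1 := measurePreserving_arrowProdEquivProdArrow Y Y ι (fun _ => ν) (fun _ => ν)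
  have E2 := measurePreserving_arrowProdEquivProdArrow X (Y × Y) ι (fun _ => μ)
    (fun _ => ν.prod ν)
  have E3 := measurePreserving_arrowProdEquivProdArrow X Z ι (fun _ => μ) (fun _ => ν')
  have hL := ((MeasurePreserving.id (Measure.pi fun _ : ι => μ)).prod E1).comp E2
  have key : (Measure.pi fun _ : ι => μ.prod (ν.prod ν)).map
      (fun w e => (f ((w e).1, (w e).2.1), f ((w e).1, (w e).2.2))) =
      (Measure.pi fun _ : ι => μ.prod ν').map (fun w e => ((w e).1, f' (w e))) := by
    rw [Measure.pi_map_pi (f := fun _ (p : X × Y × Y) => (f (p.1, p.2.1), f (p.1, p.2.2)))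
        (fun _ => by fun_prop),
      Measure.pi_map_pi (f := fun _ (p : X × Z) => (p.1, f' p)) (fun _ => by fun_prop), hlaw]
  have key2 := congrArg (Measure.map (MeasurableEquiv.arrowProdEquivProdArrow X X ι)) key
  rw [Measure.map_map (by fun_prop) (by fun_prop), Measure.map_map (by fun_prop) (by fun_prop)]
    at key2
  rw [← hL.map_eq, ← E3.map_eq, Measure.map_map (by fun_prop) hL.measurable,
    Measure.map_map (by fun_prop) E3.measurable]
  exact key2

lemma charFun_linear_two (c d : ℝ) :
    ∫ p : ℝ × ℝ, Complex.exp ((c * p.1 + d * p.2 : ℝ) * Complex.I)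
        ∂(gaussianReal 0 1).prod (gaussianReal 0 1) =
      Complex.exp ((-(c ^ 2 + d ^ 2) / 2 : ℝ)) := by
  have h : ∀ p : ℝ × ℝ, Complex.exp ((c * p.1 + d * p.2 : ℝ) * Complex.I) =
      Complex.exp (c * p.1 * Complex.I) * Complex.exp (d * p.2 * Complex.I) := by
    intro p
    rw [← Complex.exp_add]
    push_cast
    ring_nf
  simp_rw [h]
  rw [integral_prod_mul (fun x : ℝ => Complex.exp (c * x * Complex.I))
    (fun x : ℝ => Complex.exp (d * x * Complex.I)), ← charFun_apply_real, ← charFun_apply_real,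
    charFun_gaussianReal, charFun_gaussianReal, ← Complex.exp_add]
  push_cast
  ring_nf

lemma charFun_linear_three (c d e : ℝ) :
    ∫ p : ℝ × ℝ × ℝ, Complex.exp ((c * p.1 + d * p.2.1 + e * p.2.2 : ℝ) * Complex.I)
        ∂(gaussianReal 0 1).prod ((gaussianReal 0 1).prod (gaussianReal 0 1)) =
      Complex.exp ((-(c ^ 2 + d ^ 2 + e ^ 2) / 2 : ℝ)) := by
  have h : ∀ p : ℝ × ℝ × ℝ,
      Complex.exp ((c * p.1 + d * p.2.1 + e * p.2.2 : ℝ) * Complex.I) =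
      Complex.exp (c * p.1 * Complex.I) *
        Complex.exp ((d * p.2.1 + e * p.2.2 : ℝ) * Complex.I) := by
    intro p
    rw [← Complex.exp_add]
    push_cast
    ring_nf
  simp_rw [h]
  rw [integral_prod_mul (fun x : ℝ => Complex.exp (c * x * Complex.I))
    (fun q : ℝ × ℝ => Complex.exp ((d * q.1 + e * q.2 : ℝ) * Complex.I)), ← charFun_apply_real,
    charFun_linear_two, charFun_gaussianReal, ← Complex.exp_add]
  push_cast
  ring_nf

/-- Two independent Gaussian updates of the same Gaussian, with correlation `a`, form a pair with
correlation `a ^ 2`. -/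
lemma gaussian_update_law {a b b' : ℝ} (hab : a ^ 2 + b ^ 2 = 1) (hab' : a ^ 4 + b' ^ 2 = 1) :
    ((gaussianReal 0 1).prod ((gaussianReal 0 1).prod (gaussianReal 0 1))).map
        (fun p : ℝ × ℝ × ℝ => (a * p.1 + b * p.2.1, a * p.1 + b * p.2.2)) =
      ((gaussianReal 0 1).prod (gaussianReal 0 1)).map
        (fun p : ℝ × ℝ => (p.1, a ^ 2 * p.1 + b' * p.2)) := by
  have hm1 : Measurable fun p : ℝ × ℝ × ℝ => (a * p.1 + b * p.2.1, a * p.1 + b * p.2.2) := by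
    fun_prop
  have hm2 : Measurable fun p : ℝ × ℝ => (p.1, a ^ 2 * p.1 + b' * p.2) := by fun_prop
  have := Measure.isProbabilityMeasure_map
    (μ := (gaussianReal 0 1).prod ((gaussianReal 0 1).prod (gaussianReal 0 1))) hm1.aemeasurable
  have := Measure.isProbabilityMeasure_map
    (μ := (gaussianReal 0 1).prod (gaussianReal 0 1)) hm2.aemeasurable
  refine Measure.ext_of_charFunDual ?_
  funext L
  have hL : ∀ u v : ℝ, L (u, v) = L (1, 0) * u + L (0, 1) * v := by
    intro u v
    have : ((u, v) : ℝ × ℝ) = u • ((1, 0) : ℝ × ℝ) + v • ((0, 1) : ℝ × ℝ) := by simp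
    rw [this, map_add, map_smul, map_smul, smul_eq_mul, smul_eq_mul]
    ring
  set c := L (1, 0)
  set d := L (0, 1)
  rw [charFunDual_apply, charFunDual_apply, integral_map hm1.aemeasurable
    (Measurable.aestronglyMeasurable (by fun_prop)), integral_map hm2.aemeasurable
    (Measurable.aestronglyMeasurable (by fun_prop))]
  have e1 : ∀ p : ℝ × ℝ × ℝ, L (a * p.1 + b * p.2.1, a * p.1 + b * p.2.2) =
      ((c + d) * a) * p.1 + (c * b) * p.2.1 + (d * b) * p.2.2 := by
    intro p; rw [hL]; ring
  have e2 : ∀ p : ℝ × ℝ, L (p.1, a ^ 2 * p.1 + b' * p.2) =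
      (c + d * a ^ 2) * p.1 + (d * b') * p.2 := by
    intro p; rw [hL]; ring
  simp_rw [e1, e2]
  rw [charFun_linear_three, charFun_linear_two]
  congr 2
  linear_combination (-(c ^ 2 + d ^ 2) / 2) * hab + (d ^ 2 / 2) * hab'

lemma isProbabilityMeasure_berBool {p : ℝ} (h0 : 0 ≤ p) (h1 : p ≤ 1) :
    IsProbabilityMeasure (berBool p) := by
  constructor
  simp only [berBool, Measure.coe_add, Pi.add_apply, Measure.smul_apply, smul_eq_mul,
    measure_univ, mul_one]
  rw [← ENNReal.ofReal_add h0 (by linarith)]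
  simp

lemma lintegral_berBool (p : ℝ) (f : Bool → ENNReal) :
    ∫⁻ b, f b ∂berBool p = ENNReal.ofReal p * f true + ENNReal.ofReal (1 - p) * f false := by
  simp [berBool, lintegral_add_measure, lintegral_smul_measure]

/-- Two independent resamplings of the same variable, each retained with probability `p`, form a
pair in which the variable is retained with probability `p ^ 2`. -/
lemma resample_update_law {X : Type*} [MeasurableSpace X] (μ : Measure X) [IsProbabilityMeasure μ]
    {p : ℝ} (h0 : 0 ≤ p) (h1 : p ≤ 1) :
    (μ.prod ((μ.prod (berBool p)).prod (μ.prod (berBool p)))).map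
        (fun q : X × (X × Bool) × (X × Bool) =>
          (if q.2.1.2 then q.1 else q.2.1.1, if q.2.2.2 then q.1 else q.2.2.1)) =
      (μ.prod (μ.prod (berBool (p ^ 2)))).map
        (fun q : X × X × Bool => (q.1, if q.2.2 then q.1 else q.2.1)) := by
  have := isProbabilityMeasure_berBool h0 h1
  have hsel : Measurable fun q : X × X × Bool => if q.2.2 then q.1 else q.2.1 :=
    Measurable.ite (by measurability) measurable_fst measurable_snd.fst
  have hm2 : Measurable fun q : X × X × Bool => (q.1, if q.2.2 then q.1 else q.2.1) :=
    measurable_fst.prodMk hsel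
  have hm1 : Measurable fun q : X × (X × Bool) × (X × Bool) =>
      (if q.2.1.2 then q.1 else q.2.1.1, if q.2.2.2 then q.1 else q.2.2.1) :=
    (hsel.comp (measurable_fst.prodMk measurable_snd.fst)).prodMk
      (hsel.comp (measurable_fst.prodMk measurable_snd.snd))
  refine Measure.ext_of_lintegral _ fun f hf => ?_
  rw [lintegral_map hf hm1, lintegral_map hf hm2]
  set P := ENNReal.ofReal p
  set Q := ENNReal.ofReal (1 - p)
  set D := ∫⁻ x, f (x, x) ∂μ
  set I := ∫⁻ x, ∫⁻ y, f (x, y) ∂μ ∂μ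
  have hR : ∫⁻ q : X × X × Bool, f (q.1, if q.2.2 then q.1 else q.2.1)
      ∂μ.prod (μ.prod (berBool (p ^ 2))) =
      ENNReal.ofReal (p ^ 2) * D + ENNReal.ofReal (1 - p ^ 2) * I := by
    rw [lintegral_prod]
    swap
    · exact (hf.comp hm2).aemeasurable
    have : ∀ x, ∫⁻ w : X × Bool, f (x, if w.2 then x else w.1) ∂μ.prod (berBool (p ^ 2)) =
        ENNReal.ofReal (p ^ 2) * f (x, x) + ENNReal.ofReal (1 - p ^ 2) * ∫⁻ y, f (x, y) ∂μ := by
      intro x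
      rw [lintegral_prod]
      swap
      · exact ((hf.comp hm2).comp measurable_prodMk_left).aemeasurable
      simp only [lintegral_berBool, if_true, Bool.false_eq_true, if_false]
      rw [lintegral_add_left (by fun_prop), lintegral_const, lintegral_const_mul _ (by fun_prop)]
      simp
    simp only [this]
    rw [lintegral_add_left (by fun_prop), lintegral_const_mul _ (by fun_prop),
      lintegral_const_mul _ (by fun_prop)]
  have hL : ∫⁻ q : X × (X × Bool) × (X × Bool),
      f (if q.2.1.2 then q.1 else q.2.1.1, if q.2.2.2 then q.1 else q.2.2.1)
      ∂μ.prod ((μ.prod (berBool p)).prod (μ.prod (berBool p))) =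
      P * (P * D + Q * I) + Q * (P * I + Q * I) := by
    have inner : ∀ x x' : X, ∫⁻ w : X × Bool, f (x', if w.2 then x else w.1)
        ∂μ.prod (berBool p) = P * f (x', x) + Q * ∫⁻ z, f (x', z) ∂μ := by
      intro x x'
      rw [lintegral_prod]
      swap
      · exact (hf.comp (measurable_const.prodMk
          (hsel.comp measurable_prodMk_left))).aemeasurable
      simp only [lintegral_berBool, if_true, Bool.false_eq_true, if_false]
      rw [lintegral_add_left (by fun_prop), lintegral_const, lintegral_const_mul _ (by fun_prop)]
      simp [P, Q]
    have mid : ∀ x : X, ∫⁻ w : (X × Bool) × (X × Bool),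
        f (if w.1.2 then x else w.1.1, if w.2.2 then x else w.2.1)
        ∂(μ.prod (berBool p)).prod (μ.prod (berBool p)) =
        P * (P * f (x, x) + Q * ∫⁻ z, f (x, z) ∂μ) +
          Q * (P * ∫⁻ y, f (y, x) ∂μ + Q * I) := by
      intro x
      rw [lintegral_prod]
      swap
      · exact ((hf.comp hm1).comp measurable_prodMk_left).aemeasurable
      simp only [inner]
      rw [lintegral_prod]
      · simp only [lintegral_berBool, if_true, Bool.false_eq_true, if_false]
        rw [lintegral_add_left (by fun_prop), lintegral_const, lintegral_const_mul _ (by fun_prop),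
          lintegral_add_left (by fun_prop), lintegral_const_mul _ (by fun_prop),
          lintegral_const_mul _ (by fun_prop)]
        simp [P, Q, I]
      · have hs : Measurable fun w : X × Bool => if w.2 then x else w.1 :=
          hsel.comp measurable_prodMk_left
        have hg : Measurable fun y => P * f (y, x) + Q * ∫⁻ z, f (y, z) ∂μ := by fun_prop
        exact (hg.comp hs).aemeasurable
    rw [lintegral_prod]
    swap
    · exact (hf.comp hm1).aemeasurable
    simp only [mid]
    have hsw : ∫⁻ x, ∫⁻ y, f (y, x) ∂μ ∂μ = I :=
      lintegral_lintegral_swap (f := fun x y => f (y, x)) (by fun_prop)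
    rw [lintegral_add_left (by fun_prop), lintegral_const_mul _ (by fun_prop),
      lintegral_add_left (by fun_prop), lintegral_const_mul _ (by fun_prop),
      lintegral_const_mul _ (by fun_prop), lintegral_const_mul _ (by fun_prop),
      lintegral_add_left (by fun_prop), lintegral_const_mul _ (by fun_prop), hsw]
    simp [D, I]
  rw [hL, hR]
  have e1 : ENNReal.ofReal (p ^ 2) = P * P := by rw [sq, ENNReal.ofReal_mul h0]
  have e2 : ENNReal.ofReal (1 - p ^ 2) = P * Q + Q * P + Q * Q := by
    have hq : 0 ≤ 1 - p := by linarith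
    rw [← ENNReal.ofReal_mul h0, ← ENNReal.ofReal_mul hq, ← ENNReal.ofReal_mul hq,
      ← ENNReal.ofReal_add (by positivity) (by positivity),
      ← ENNReal.ofReal_add (by positivity) (by positivity)]
    ring_nf
  rw [e1, e2]
  ring

lemma pi_withDensity {ι W : Type*} [Fintype ι] [MeasurableSpace W] (κ : Measure W)
    [IsProbabilityMeasure κ] {f : W → ENNReal} (hf : Measurable f)
    [IsProbabilityMeasure (κ.withDensity f)] :
    (Measure.pi fun _ : ι => κ.withDensity f) =
      (Measure.pi fun _ : ι => κ).withDensity fun w => ∏ e, f (w e) := by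
  refine Measure.pi_eq fun s hs => ?_
  have hind : iIndepFun (fun (e : ι) (w : ι → W) => (s e).indicator f (w e))
      (Measure.pi fun _ : ι => κ) :=
    iIndepFun_pi (X := fun e => (s e).indicator f) fun e => (hf.indicator (hs e)).aemeasurable
  rw [withDensity_apply _ (MeasurableSet.univ_pi hs),
    ← lintegral_indicator (MeasurableSet.univ_pi hs)]
  have h1 : ∀ w : ι → W, (Set.univ.pi s).indicator (fun w => ∏ e, f (w e)) w =
      ∏ e, (s e).indicator f (w e) := by
    intro w
    by_cases hw : w ∈ Set.univ.pi s
    · rw [Set.indicator_of_mem hw]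
      exact Finset.prod_congr rfl fun e _ => (Set.indicator_of_mem (hw e trivial) f).symm
    · rw [Set.indicator_of_notMem hw]
      simp only [Set.mem_pi, Set.mem_univ, true_imp_iff, not_forall] at hw
      obtain ⟨e, he⟩ := hw
      exact (Finset.prod_eq_zero (Finset.mem_univ e) (Set.indicator_of_notMem he f)).symm
  simp_rw [h1]
  have h2 := lintegral_prod_eq_prod_lintegral_of_indepFun Finset.univ
    (fun (e : ι) (w : ι → W) => (s e).indicator f (w e)) hind
    fun e => (hf.indicator (hs e)).comp (measurable_pi_apply e)
  rw [h2]
  refine Finset.prod_congr rfl fun e _ => ?_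
  rw [withDensity_apply _ (hs e), ← lintegral_indicator (hs e),
    (measurePreserving_eval (fun _ : ι => κ) e).lintegral_comp (hf.indicator (hs e))]

lemma measurePreserving_gaussianPi_flip {ι : Type*} [Fintype ι] {ε : ι → ℝ}
    (hε : ∀ e, ε e = 1 ∨ ε e = -1) :
    MeasurePreserving (fun (x : ι → ℝ) e => ε e * x e) (gaussianPi ι) (gaussianPi ι) := by
  refine measurePreserving_pi (fun _ => gaussianReal 0 1) (fun _ => gaussianReal 0 1)
    (f := fun e x => ε e * x) fun e => ⟨by fun_prop, ?_⟩
  rw [gaussianReal_map_const_mul]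
  rcases hε e with h | h <;> simp [h]

lemma integral_eq_zero_of_measurePreserving_neg {Ω : Type*} [MeasurableSpace Ω] {P : Measure Ω}
    {T : Ω → Ω} (hT : MeasurePreserving T P P) {g : Ω → ℝ} (hg : Measurable g)
    (hneg : ∀ ω, g (T ω) = -g ω) : ∫ ω, g ω ∂P = 0 := by
  have h : ∫ ω, g ω ∂P = ∫ ω, g (T ω) ∂P := by
    conv_lhs => rw [← hT.map_eq]
    exact integral_map hT.aemeasurable hg.aestronglyMeasurable
  simp only [hneg, integral_neg] at h
  linarith

/-- The density of a pair of standard Gaussians with correlation `a` with respect to a pair of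
independent ones is close to `1` in `L¹`. -/
lemma exists_density_correlated_gaussian {a b : ℝ} (ha : 0 < a) (ha2 : a ≤ 1 / 2)
    (hab : a ^ 2 + b ^ 2 = 1) :
    ∃ k : ℝ × ℝ → ℝ, Measurable k ∧ (∀ p, 0 ≤ 1 + k p) ∧
      Integrable k ((gaussianReal 0 1).prod (gaussianReal 0 1)) ∧
      ∫ p, |k p| ∂(gaussianReal 0 1).prod (gaussianReal 0 1) ≤ 4 * a ∧
      ((gaussianReal 0 1).prod (gaussianReal 0 1)).map
          (fun p : ℝ × ℝ => (p.1, a * p.1 + b * p.2)) =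
        ((gaussianReal 0 1).prod (gaussianReal 0 1)).withDensity
          fun p => ENNReal.ofReal (1 + k p) := by
  set γ := gaussianReal 0 1
  have hb2 : (0 : ℝ) < b ^ 2 := by nlinarith
  have hb21 : b ^ 2 ≤ 1 := by nlinarith [sq_nonneg a]
  obtain ⟨v, hvb⟩ : ∃ v : NNReal, (v : ℝ) = b ^ 2 :=
    ⟨(b ^ 2).toNNReal, Real.coe_toNNReal _ hb2.le⟩
  have hv0 : v ≠ 0 := by
    rintro rfl
    exact hb2.ne hvb
  have hγ : γ = volume.withDensity (gaussianPDF 0 1) := gaussianReal_of_var_ne_zero 0 one_ne_zero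
  set m : ℝ × ℝ → ℝ := fun p => gaussianPDFReal (a * p.1) v p.2 / gaussianPDFReal 0 1 p.2 with hm
  have hmm : Measurable m := by
    simp only [hm, gaussianPDFReal]
    fun_prop
  have hm0 : ∀ p, 0 ≤ m p := fun p =>
    div_nonneg (gaussianPDFReal_nonneg _ _ _) (gaussianPDFReal_nonneg _ _ _)
  have hlaw : (γ.prod γ).map (fun p : ℝ × ℝ => (p.1, a * p.1 + b * p.2)) =
      (γ.prod γ).withDensity fun p => ENNReal.ofReal (m p) := by
    refine Measure.ext_of_lintegral _ fun f hf => ?_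
    rw [lintegral_map hf (by fun_prop),
      lintegral_withDensity_eq_lintegral_mul _ (by fun_prop) hf]
    rw [lintegral_prod _ (by fun_prop), lintegral_prod _ (by fun_prop)]
    refine lintegral_congr fun x => ?_
    have h1 : γ.map (fun y => a * x + b * y) = gaussianReal (a * x) v := by
      have : (fun y => a * x + b * y) = (fun y => a * x + y) ∘ (fun y => b * y) := rfl
      rw [this, ← Measure.map_map (by fun_prop) (by fun_prop), gaussianReal_map_const_mul,
        gaussianReal_map_const_add]
      congr 1
      · simp
      · exact NNReal.eq (by simpa using hvb.symm)
    have h2 : ∫⁻ y, f (x, a * x + b * y) ∂γ = ∫⁻ z, f (x, z) ∂γ.map (fun y => a * x + b * y) := by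
      rw [lintegral_map (by fun_prop) (by fun_prop)]
    rw [h2, h1, gaussianReal_of_var_ne_zero _ hv0, hγ,
      lintegral_withDensity_eq_lintegral_mul _ (measurable_gaussianPDF _ _) (by fun_prop),
      lintegral_withDensity_eq_lintegral_mul _ (measurable_gaussianPDF _ _) (by fun_prop)]
    refine lintegral_congr fun z => ?_
    simp only [Pi.mul_apply]
    rw [← mul_assoc]
    congr 1
    simp only [gaussianPDF, hm]
    rw [← ENNReal.ofReal_mul (gaussianPDFReal_nonneg _ _ _),
      mul_div_cancel₀ _ (gaussianPDFReal_pos _ _ _ one_ne_zero).ne']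
  have hmass : ∫⁻ p, ENNReal.ofReal (m p) ∂γ.prod γ = 1 := by
    have := congrArg (fun ν : Measure (ℝ × ℝ) => ν Set.univ) hlaw
    simp only [withDensity_apply _ MeasurableSet.univ, Measure.restrict_univ] at this
    rw [← this, Measure.map_apply (by fun_prop) MeasurableSet.univ]
    simp
  have hmint : Integrable m (γ.prod γ) := by
    refine ⟨hmm.aestronglyMeasurable, ?_⟩
    rw [hasFiniteIntegral_iff_ofReal (Filter.Eventually.of_forall hm0), hmass]
    exact ENNReal.one_lt_top
  have hm1 : ∫ p, m p ∂γ.prod γ = 1 := by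
    rw [integral_eq_lintegral_of_nonneg_ae (Filter.Eventually.of_forall hm0)
      hmm.aestronglyMeasurable, hmass, ENNReal.toReal_one]
  have hsq : Integrable (fun x : ℝ => x ^ 2) γ := (memLp_id_gaussianReal 2).integrable_sq
  have hsqv : ∫ x, x ^ 2 ∂γ = 1 := by
    have h := variance_fun_id_gaussianReal (μ := 0) (v := 1)
    rw [variance_eq_sub (X := fun x => x) (memLp_id_gaussianReal 2)] at h
    simpa [γ] using h
  have hi1 : Integrable (fun p : ℝ × ℝ => p.1 ^ 2) (γ.prod γ) := hsq.comp_fst γ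
  have hi2 : Integrable (fun p : ℝ × ℝ => p.2 ^ 2) (γ.prod γ) := hsq.comp_snd γ
  have hv1 : ∫ p : ℝ × ℝ, p.1 ^ 2 ∂γ.prod γ = 1 := by
    rw [integral_fun_fst (fun x : ℝ => x ^ 2)]; simp [hsqv]
  have hv2 : ∫ p : ℝ × ℝ, p.2 ^ 2 ∂γ.prod γ = 1 := by
    rw [integral_fun_snd (fun x : ℝ => x ^ 2)]; simp [hsqv]
  have hlow : ∀ p, 1 - a * (p.1 ^ 2 + p.2 ^ 2) ≤ m p := by
    rintro ⟨x, z⟩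
    have hform : m (x, z) = (√(b ^ 2))⁻¹ *
        Real.exp (z ^ 2 / 2 - (z - a * x) ^ 2 / (2 * b ^ 2)) := by
      simp only [hm, gaussianPDFReal, hvb, NNReal.coe_one, mul_one, sub_zero]
      rw [Real.exp_sub, show -z ^ 2 / 2 = -(z ^ 2 / 2) by ring,
        show -(z - a * x) ^ 2 / (2 * b ^ 2) = -((z - a * x) ^ 2 / (2 * b ^ 2)) by ring,
        Real.exp_neg, Real.exp_neg, Real.sqrt_mul (by positivity) (b ^ 2)]
      have : √(2 * π) ≠ 0 := by positivity
      have : √(b ^ 2) ≠ 0 := by positivity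
      field_simp
    have hs : 1 ≤ (√(b ^ 2))⁻¹ :=
      (one_le_inv₀ (by positivity)).2 (Real.sqrt_le_one.2 hb21)
    have hu : -(a * (x ^ 2 + z ^ 2)) ≤ z ^ 2 / 2 - (z - a * x) ^ 2 / (2 * b ^ 2) := by
      rw [div_sub_div _ _ two_ne_zero (by positivity), le_div_iff₀ (by positivity)]
      have hb : b ^ 2 = 1 - a ^ 2 := by linarith
      rw [hb]
      have h3 : 0 ≤ a * (1 / 2 - a) := by nlinarith
      have h4 : 0 ≤ a * (1 + a) := by positivity
      nlinarith [mul_nonneg ha.le (sq_nonneg (x + z)), mul_nonneg h3 (sq_nonneg x),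
        mul_nonneg h3 (sq_nonneg z), mul_nonneg (mul_nonneg h3 ha.le) (sq_nonneg x),
        mul_nonneg (mul_nonneg h3 ha.le) (sq_nonneg z)]
    rw [hform]
    have he := Real.add_one_le_exp (z ^ 2 / 2 - (z - a * x) ^ 2 / (2 * b ^ 2))
    have h5 := le_mul_of_one_le_left
      (Real.exp_pos (z ^ 2 / 2 - (z - a * x) ^ 2 / (2 * b ^ 2))).le hs
    dsimp only
    linarith
  have habs : ∀ p, |m p - 1| ≤ (m p - 1) + 2 * a * (p.1 ^ 2 + p.2 ^ 2) := by
    intro p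
    have h0 : 0 ≤ a * (p.1 ^ 2 + p.2 ^ 2) := by positivity
    have := hlow p
    rw [abs_le]
    constructor <;> linarith
  have hkint : Integrable (fun p => m p - 1) (γ.prod γ) := hmint.sub (integrable_const 1)
  refine ⟨fun p => m p - 1, hmm.sub_const 1, fun p => by simpa using hm0 p, hkint, ?_, ?_⟩
  · refine (integral_mono hkint.abs (hkint.add ((hi1.add hi2).const_mul (2 * a))) habs).trans ?_
    rw [integral_add' hkint ((hi1.add hi2).const_mul (2 * a)), integral_const_mul,
      integral_sub hmint (integrable_const 1), hm1, integral_add' hi1 hi2, hv1, hv2]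
    simp
    linarith
  · simpa using hlaw

lemma abs_integral_mul_prod_one_add_le {ι W : Type*} [Fintype ι] [MeasurableSpace W]
    (κ : Measure W) [IsProbabilityMeasure κ] {k : W → ℝ} (hk : Integrable k κ)
    {ψ : (ι → W) → ℝ} (hψ : Measurable ψ) (hb : ∀ w, |ψ w| ≤ 1) {r : ℕ} {D : ℝ} (hD : 0 ≤ D)
    (hzero : ∀ S : Finset ι, S.card ≤ r →
      ∫ w, ψ w * ∏ e ∈ S, k (w e) ∂(Measure.pi fun _ => κ) = 0)
    (hlarge : ∀ S : Finset ι, r ≤ S.card → (∫ x, |k x| ∂κ) ^ S.card ≤ D) :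
    |∫ w, ψ w * ∏ e, (1 + k (w e)) ∂(Measure.pi fun _ => κ)| ≤ 2 ^ Fintype.card ι * D := by
  classical
  have hprod : ∀ S : Finset ι, Integrable (fun w : ι → W => ∏ e ∈ S, k (w e))
      (Measure.pi fun _ => κ) := by
    intro S
    have h := Integrable.fintype_prod (μ := fun _ : ι => κ)
      (f := fun e x => if e ∈ S then k x else 1) fun e => by
        by_cases he : e ∈ S
        · simpa [he] using hk
        · simp [he]
    simpa [Finset.prod_ite_mem] using h
  have hterm : ∀ S : Finset ι, Integrable (fun w : ι → W => ψ w * ∏ e ∈ S, k (w e))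
      (Measure.pi fun _ => κ) := fun S =>
    (hprod S).bdd_mul (c := 1) hψ.aestronglyMeasurable (Filter.Eventually.of_forall hb)
  have hval : ∀ S : Finset ι, ∫ w : ι → W, ∏ e ∈ S, |k (w e)| ∂(Measure.pi fun _ => κ) =
      (∫ x, |k x| ∂κ) ^ S.card := by
    intro S
    have h := integral_fintype_prod_eq_prod (μ := fun _ : ι => κ)
      (fun (e : ι) x => if e ∈ S then |k x| else 1)
    have h2 : ∀ e : ι, ∫ x, (if e ∈ S then |k x| else 1) ∂κ =
        if e ∈ S then ∫ x, |k x| ∂κ else 1 := by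
      intro e
      by_cases he : e ∈ S <;> simp [he]
    simp only [h2, Finset.prod_ite_mem, Finset.univ_inter, Finset.prod_const] at h
    exact h
  have hexp : ∀ w : ι → W, ψ w * ∏ e, (1 + k (w e)) =
      ∑ S ∈ (Finset.univ : Finset ι).powerset, ψ w * ∏ e ∈ S, k (w e) := by
    intro w
    rw [Finset.prod_one_add, Finset.mul_sum]
  simp_rw [hexp]
  rw [integral_finsetSum _ fun S _ => hterm S]
  refine (Finset.abs_sum_le_sum_abs _ _).trans ?_
  refine (Finset.sum_le_card_nsmul _ _ D fun S _ => ?_).trans_eq (by simp)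
  rcases le_total S.card r with hS | hS
  · rw [hzero S hS, abs_zero]
    exact hD
  · refine (abs_integral_le_integral_abs).trans (le_trans ?_ (hlarge S hS))
    rw [← hval S]
    refine integral_mono (hterm S).abs ?_ fun w => ?_
    · simpa only [Finset.abs_prod] using (hprod S).abs
    · simp only [abs_mul, Finset.abs_prod]
      exact mul_le_of_le_one_left (Finset.prod_nonneg fun _ _ => abs_nonneg _) (hb w)

lemma abs_integral_mul_linear_le {ι : Type*} [Fintype ι] {φ : (ι → ℝ) → ℝ} (hφ : Measurable φ)
    (hb : ∀ x, |φ x| ≤ 1) {r : ℕ} (hodd : OddOutside r φ) {a b : ℝ} (ha : 0 < a) (ha2 : a ≤ 1 / 2)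
    (hab : a ^ 2 + b ^ 2 = 1) :
    |∫ ω, φ ω.1 * φ (fun e => a * ω.1 e + b * ω.2 e) ∂pairGauss ι| ≤
      2 ^ Fintype.card ι * (4 ^ Fintype.card ι * a ^ r) := by
  obtain ⟨k, hk, hk0, hki, hk4, hlaw⟩ := exists_density_correlated_gaussian ha ha2 hab
  set γ := gaussianReal 0 1 with hγ
  set κ := γ.prod γ
  set ψ : (ι → ℝ × ℝ) → ℝ := fun w => φ (fun e => (w e).1) * φ (fun e => (w e).2) with hψ
  have hψm : Measurable ψ := by fun_prop
  have hψb : ∀ w, |ψ w| ≤ 1 := fun w => abs_mul_le_one (hb _) (hb _)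
  have hu : Measurable fun p : ℝ × ℝ => (p.1, a * p.1 + b * p.2) := by fun_prop
  have hprob : IsProbabilityMeasure (κ.withDensity fun p => ENNReal.ofReal (1 + k p)) := by
    rw [← hlaw]
    exact Measure.isProbabilityMeasure_map hu.aemeasurable
  have E := measurePreserving_arrowProdEquivProdArrow ℝ ℝ ι (fun _ => γ) (fun _ => γ)
  have heq : ∫ ω, φ ω.1 * φ (fun e => a * ω.1 e + b * ω.2 e) ∂pairGauss ι =
      ∫ w, ψ w * ∏ e, (1 + k (w e)) ∂(Measure.pi fun _ : ι => κ) := by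
    have h1 : ∫ ω, φ ω.1 * φ (fun e => a * ω.1 e + b * ω.2 e) ∂pairGauss ι =
        ∫ w, ψ (fun e => ((w e).1, a * (w e).1 + b * (w e).2)) ∂(Measure.pi fun _ : ι => κ) := by
      have hP : pairGauss ι = (Measure.pi fun _ : ι => γ).prod (Measure.pi fun _ : ι => γ) := rfl
      rw [hP, ← E.map_eq, integral_map E.aemeasurable
        (Measurable.aestronglyMeasurable (by fun_prop))]
      rfl
    have h2 := Measure.pi_map_pi (μ := fun _ : ι => κ)
      (f := fun _ (p : ℝ × ℝ) => (p.1, a * p.1 + b * p.2)) (fun _ => hu.aemeasurable)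
    have h3 : ∫ w, ψ (fun e => ((w e).1, a * (w e).1 + b * (w e).2))
        ∂(Measure.pi fun _ : ι => κ) = ∫ w, ψ w ∂(Measure.pi fun _ : ι => κ).map
          (fun w e => ((w e).1, a * (w e).1 + b * (w e).2)) := by
      rw [integral_map (by fun_prop) hψm.aestronglyMeasurable]
    rw [h1, h3, h2, hlaw, pi_withDensity κ (by fun_prop),
      integral_withDensity_eq_integral_toReal_smul (by fun_prop)
        (Filter.Eventually.of_forall fun w => ENNReal.prod_lt_top fun e _ =>
          ENNReal.ofReal_lt_top)]
    refine integral_congr_ae (Filter.Eventually.of_forall fun w => ?_)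
    simp only [ENNReal.toReal_prod, ENNReal.toReal_ofReal (hk0 _), smul_eq_mul]
    ring
  rw [heq]
  refine abs_integral_mul_prod_one_add_le κ hki hψm hψb (r := r) (by positivity) (fun S hS => ?_)
    fun S hS => ?_
  · obtain ⟨ε, hε, hεS, hφε⟩ := hodd S hS
    have hT : MeasurePreserving (fun (w : ι → ℝ × ℝ) e => (ε e * (w e).1, (w e).2))
        (Measure.pi fun _ : ι => κ) (Measure.pi fun _ : ι => κ) := by
      refine measurePreserving_pi (fun _ => κ) (fun _ => κ)
        (f := fun e p => (ε e * p.1, p.2)) fun e => ?_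
      have h1 : MeasurePreserving (fun x => ε e * x) γ γ := by
        refine ⟨by fun_prop, ?_⟩
        rw [hγ, gaussianReal_map_const_mul]
        rcases hε e with h | h <;> simp [h]
      exact h1.prod (MeasurePreserving.id γ)
    refine integral_eq_zero_of_measurePreserving_neg hT (by fun_prop) fun w => ?_
    have h1 : ψ (fun e => (ε e * (w e).1, (w e).2)) = -ψ w := by
      simp only [hψ]
      rw [hφε, neg_mul]
    rw [h1, neg_mul]
    congr 2
    exact Finset.prod_congr rfl fun e he => by beta_reduce; rw [hεS e he, one_mul]
  · have hn : S.card ≤ Fintype.card ι := Finset.card_le_univ S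
    calc (∫ x, |k x| ∂κ) ^ S.card ≤ (4 * a) ^ S.card :=
          pow_le_pow_left₀ (integral_nonneg fun _ => abs_nonneg _) hk4 _
      _ = 4 ^ S.card * a ^ S.card := mul_pow _ _ _
      _ ≤ 4 ^ Fintype.card ι * a ^ r := by
          refine mul_le_mul (pow_le_pow_right₀ (by norm_num) hn)
            (pow_le_pow_of_le_one ha.le (by linarith) hS) (by positivity) (by positivity)

lemma measurable_discPerturb {ι : Type*} [Fintype ι] :
    Measurable fun ω : (ι → ℝ) × (ι → ℝ) × (ι → Bool) => discPerturb ω.1 ω.2.1 ω.2.2 := by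
  refine measurable_pi_lambda _ fun e => ?_
  refine Measurable.ite ?_ (by fun_prop) (by fun_prop)
  exact (show Measurable fun ω : (ι → ℝ) × (ι → ℝ) × (ι → Bool) => ω.2.2 e by fun_prop)
    (measurableSet_singleton true)

lemma abs_integral_mul_discPerturb_le {ι : Type*} [Fintype ι] {φ : (ι → ℝ) → ℝ}
    (hφ : Measurable φ) (hb : ∀ x, |φ x| ≤ 1) {r : ℕ} (hodd : OddOutside r φ) {p : ℝ}
    (h0 : 0 ≤ p) (h1 : p ≤ 1) :
    |∫ ω, φ ω.1 * φ (discPerturb ω.1 ω.2.1 ω.2.2) ∂tripleGaussBer ι p| ≤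
      2 ^ Fintype.card ι * p ^ r := by
  classical
  have hprob := isProbabilityMeasure_berBool h0 h1
  set P := tripleGaussBer ι p with hP
  have hPprob : IsProbabilityMeasure P := by rw [hP, tripleGaussBer]; infer_instance
  have hdm := measurable_discPerturb (ι := ι)
  set g : (ι → Bool) → (ι → ℝ) × (ι → ℝ) × (ι → Bool) → ℝ := fun B ω =>
    ((fun ω : (ι → ℝ) × (ι → ℝ) × (ι → Bool) => ω.2.2) ⁻¹' {B}).indicator
      (fun ω => φ ω.1 * φ (discPerturb ω.1 ω.2.1 ω.2.2)) ω with hg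
  have hsm : ∀ B : ι → Bool, MeasurableSet
      ((fun ω : (ι → ℝ) × (ι → ℝ) × (ι → Bool) => ω.2.2) ⁻¹' {B}) := fun B =>
    (show Measurable fun ω : (ι → ℝ) × (ι → ℝ) × (ι → Bool) => ω.2.2 by fun_prop)
      (measurableSet_singleton B)
  have hgm : ∀ B, Measurable (g B) := fun B => Measurable.indicator (by fun_prop) (hsm B)
  have hgle : ∀ B ω, |g B ω| ≤
      ((fun ω : (ι → ℝ) × (ι → ℝ) × (ι → Bool) => ω.2.2) ⁻¹' {B}).indicator 1 ω := by
    intro B ω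
    simp only [hg, Set.indicator_apply]
    split_ifs
    · exact abs_mul_le_one (hb _) (hb _)
    · simp
  have hgb : ∀ B ω, |g B ω| ≤ 1 := fun B ω =>
    (hgle B ω).trans (Set.indicator_le_self' (by simp) ω)
  have hsum : ∀ ω, φ ω.1 * φ (discPerturb ω.1 ω.2.1 ω.2.2) = ∑ B, g B ω := by
    intro ω
    simp [hg, Set.indicator_apply]
  simp_rw [hsum]
  rw [integral_finsetSum _ fun B _ => integrable_of_abs_le_one (hgm B) (hgb B)]
  refine (Finset.abs_sum_le_sum_abs _ _).trans ?_
  refine (Finset.sum_le_card_nsmul _ _ (p ^ r) fun B _ => ?_).trans_eq (by simp)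
  rcases le_total (Finset.univ.filter fun e => B e = true).card r with hS | hS
  · obtain ⟨ε, hε, hεS, hφε⟩ := hodd _ hS
    have hT : MeasurePreserving (Prod.map (fun (x : ι → ℝ) e => ε e * x e)
        (id : (ι → ℝ) × (ι → Bool) → _)) P P :=
      (measurePreserving_gaussianPi_flip hε).prod (MeasurePreserving.id _)
    rw [integral_eq_zero_of_measurePreserving_neg hT (hgm B), abs_zero]
    · positivity
    · intro ω
      simp only [hg, Set.indicator_apply, Set.mem_preimage, Set.mem_singleton_iff, Prod.map_fst,
        Prod.map_snd, id]
      split_ifs with hB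
      · rw [hφε, neg_mul]
        congr 3
        funext e
        simp only [discPerturb]
        split_ifs with he
        · rw [hεS e (by simp [← hB, he]), one_mul]
        · rfl
      · simp
  · refine abs_integral_le_integral_abs.trans ?_
    have hmono := integral_mono (integrable_of_abs_le_one (P := P) (hgm B) (hgb B)).abs
      (integrable_of_abs_le_one (P := P) (measurable_one.indicator (hsm B)) fun ω => by
        by_cases h : ω.2.2 = B <;> simp [h]) (hgle B)
    refine hmono.trans ?_
    rw [integral_indicator_one (hsm B)]
    have hset : (fun ω : (ι → ℝ) × (ι → ℝ) × (ι → Bool) => ω.2.2) ⁻¹' {B} =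
        Set.univ ×ˢ (Set.univ ×ˢ {B}) := by
      ext ω; simp
    have hmass : ∀ e, berBool p {B e} ≤ if B e = true then ENNReal.ofReal p else 1 := by
      intro e
      by_cases he : B e = true
      · simp [he, berBool]
      · simpa [he] using prob_le_one
    have hle : P {ω | ω.2.2 = B} ≤ ENNReal.ofReal (p ^ r) := by
      change P ((fun ω : (ι → ℝ) × (ι → ℝ) × (ι → Bool) => ω.2.2) ⁻¹' {B}) ≤ _
      rw [hset, hP, tripleGaussBer, Measure.prod_prod, Measure.prod_prod, measure_univ,
        one_mul, one_mul, Measure.pi_singleton]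
      refine (Finset.prod_le_prod' fun e _ => hmass e).trans ?_
      rw [Finset.prod_ite, Finset.prod_const, Finset.prod_const_one, mul_one,
        ← ENNReal.ofReal_pow h0]
      exact ENNReal.ofReal_le_ofReal (pow_le_pow_of_le_one h0 h1 hS)
    exact ENNReal.toReal_le_of_le_ofReal (by positivity) hle

lemma integral_mul_contPerturb_le {ι : Type*} [Fintype ι] {φ : (ι → ℝ) → ℝ} (hφ : Measurable φ)
    (hb : ∀ x, |φ x| ≤ 1) {r : ℕ} (hodd : OddOutside r φ) {t : ℝ} (ht : 0 ≤ t) :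
    ∫ ω, φ ω.1 * φ (contPerturb t ω.1 ω.2) ∂pairGauss ι ≤ Real.exp (-(t * r)) := by
  have hPprob : IsProbabilityMeasure (pairGauss ι) := by rw [pairGauss]; infer_instance
  rcases ht.eq_or_lt with rfl | ht
  · simpa using (abs_le.1 (abs_integral_le_one (P := pairGauss ι)
      (f := fun ω => φ ω.1 * φ (contPerturb 0 ω.1 ω.2))
      fun ω => abs_mul_le_one (hb _) (hb _))).2
  have hab : ∀ s : ℝ, 0 ≤ s → Real.exp (-s) ^ 2 + √(1 - Real.exp (-2 * s)) ^ 2 = 1 := by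
    intro s hs
    rw [Real.sq_sqrt (by rw [sub_nonneg, Real.exp_le_one_iff]; linarith), ← Real.exp_nat_mul,
      show ((2 : ℕ) : ℝ) * -s = -2 * s by push_cast; ring]
    ring
  have hmeas : ∀ s : ℝ, Measurable fun p : (ι → ℝ) × (ι → ℝ) => contPerturb s p.1 p.2 := by
    intro s
    unfold contPerturb
    fun_prop
  refine le_exp_of_sq_le_double (q := fun s => ∫ ω, φ ω.1 * φ (contPerturb s ω.1 ω.2) ∂pairGauss ι)
    (C := 2 ^ Fintype.card ι * 4 ^ Fintype.card ι) (fun s hs => ?_) (fun s hs => ?_) ht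
  · refine sq_autocorr_le (gaussianPi ι) (gaussianPi ι) (gaussianPi ι)
      (F := fun p => contPerturb s p.1 p.2) (F' := fun p => contPerturb (2 * s) p.1 p.2)
      (hmeas _) (hmeas _) ?_ hφ hb
    have hsq : Real.exp (-(2 * s)) = Real.exp (-s) ^ 2 := by
      rw [← Real.exp_nat_mul]; congr 1; push_cast; ring
    have h2 := hab (2 * s) (by linarith)
    rw [hsq, ← pow_mul] at h2
    have h := gaussian_update_law (hab s hs.le) h2
    rw [← hsq] at h
    exact map_pi_update_eq (ι := ι) (gaussianReal 0 1) (gaussianReal 0 1) (gaussianReal 0 1)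
      (f := fun p => Real.exp (-s) * p.1 + √(1 - Real.exp (-2 * s)) * p.2)
      (f' := fun p => Real.exp (-(2 * s)) * p.1 + √(1 - Real.exp (-2 * (2 * s))) * p.2)
      (by fun_prop) (by fun_prop) h
  · have ha2 : Real.exp (-s) ≤ 1 / 2 := by
      rw [Real.exp_neg, inv_le_comm₀ (Real.exp_pos _) (by norm_num)]
      linarith [Real.add_one_le_exp s]
    have h := (le_abs_self _).trans
      (abs_integral_mul_linear_le hφ hb hodd (Real.exp_pos (-s)) ha2 (hab s (by linarith)))
    refine h.trans_eq ?_
    rw [← mul_assoc, ← Real.exp_nat_mul]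
    congr 2
    ring

lemma integral_mul_discPerturb_le {ι : Type*} [Fintype ι] {φ : (ι → ℝ) → ℝ} (hφ : Measurable φ)
    (hb : ∀ x, |φ x| ≤ 1) {r : ℕ} (hodd : OddOutside r φ) {t : ℝ} (ht : 0 ≤ t) :
    ∫ ω, φ ω.1 * φ (discPerturb ω.1 ω.2.1 ω.2.2) ∂tripleGaussBer ι (Real.exp (-t)) ≤
      Real.exp (-(t * r)) := by
  have hprob : ∀ s : ℝ, 0 ≤ s → IsProbabilityMeasure (berBool (Real.exp (-s))) := fun s hs =>
    isProbabilityMeasure_berBool (Real.exp_pos _).le (Real.exp_le_one_iff.2 (by linarith))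
  rcases ht.eq_or_lt with rfl | ht
  · have := hprob 0 le_rfl
    have hPprob : IsProbabilityMeasure (tripleGaussBer ι (Real.exp (-0))) := by
      rw [tripleGaussBer]; infer_instance
    simpa using (abs_le.1 (abs_integral_le_one (P := tripleGaussBer ι (Real.exp (-0)))
      (f := fun ω => φ ω.1 * φ (discPerturb ω.1 ω.2.1 ω.2.2))
      fun ω => abs_mul_le_one (hb _) (hb _))).2
  have hdm := measurable_discPerturb (ι := ι)
  set γ := gaussianReal 0 1
  have hsite : Measurable fun q : ℝ × ℝ × Bool => if q.2.2 then q.1 else q.2.1 :=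
    Measurable.ite (by measurability) measurable_fst measurable_snd.fst
  have hF : Measurable fun p : (ι → ℝ) × (ι → ℝ × Bool) =>
      fun e => if (p.2 e).2 then p.1 e else (p.2 e).1 :=
    measurable_pi_lambda _ fun e => hsite.comp
      (show Measurable fun p : (ι → ℝ) × (ι → ℝ × Bool) => (p.1 e, p.2 e) by fun_prop)
  have htransport : ∀ s : ℝ, 0 ≤ s →
      ∫ ω, φ ω.1 * φ (discPerturb ω.1 ω.2.1 ω.2.2) ∂tripleGaussBer ι (Real.exp (-s)) =
      ∫ p, φ p.1 * φ (fun e => if (p.2 e).2 then p.1 e else (p.2 e).1)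
        ∂(gaussianPi ι).prod (Measure.pi fun _ : ι => γ.prod (berBool (Real.exp (-s)))) := by
    intro s hs
    have := hprob s hs
    have E := (MeasurePreserving.id (gaussianPi ι)).prod
      (measurePreserving_arrowProdEquivProdArrow ℝ Bool ι (fun _ => γ)
        (fun _ => berBool (Real.exp (-s))))
    have hP : tripleGaussBer ι (Real.exp (-s)) = (gaussianPi ι).prod
      ((Measure.pi fun _ : ι => γ).prod (Measure.pi fun _ : ι => berBool (Real.exp (-s)))) := rfl
    rw [hP, ← E.map_eq, integral_map E.aemeasurable
      (Measurable.aestronglyMeasurable (by fun_prop))]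
    rfl
  refine le_exp_of_sq_le_double
    (q := fun s => ∫ ω, φ ω.1 * φ (discPerturb ω.1 ω.2.1 ω.2.2) ∂tripleGaussBer ι (Real.exp (-s)))
    (C := 2 ^ Fintype.card ι) (fun s hs => ?_) (fun s hs => ?_) ht
  · have h2s : 0 ≤ 2 * s := by linarith
    have := hprob s hs.le
    have := hprob (2 * s) h2s
    rw [htransport s hs.le, htransport (2 * s) h2s]
    refine sq_autocorr_le (gaussianPi ι) (Measure.pi fun _ : ι => γ.prod (berBool (Real.exp (-s))))
      (Measure.pi fun _ : ι => γ.prod (berBool (Real.exp (-(2 * s))))) hF hF ?_ hφ hb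
    have hsq : Real.exp (-(2 * s)) = Real.exp (-s) ^ 2 := by
      rw [← Real.exp_nat_mul]; congr 1; push_cast; ring
    have h := resample_update_law γ (Real.exp_pos (-s)).le (Real.exp_le_one_iff.2 (by linarith))
    rw [← hsq] at h
    exact map_pi_update_eq (ι := ι) γ (γ.prod (berBool (Real.exp (-s))))
      (γ.prod (berBool (Real.exp (-(2 * s))))) hsite hsite h
  · have h := (le_abs_self _).trans (abs_integral_mul_discPerturb_le hφ hb hodd
      (Real.exp_pos (-s)).le (Real.exp_le_one_iff.2 (by linarith)))
    refine h.trans_eq ?_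
    rw [← Real.exp_nat_mul]
    congr 2
    ring

lemma gibbs2_sum_mul {κ : Type*} (s : Finset κ) (β c : ℝ) (H₁ H₂ : (Fin N → Bool) → ℝ)
    (f g : κ → (Fin N → Bool) → ℝ) :
    gibbs2 β H₁ H₂ (fun σ τ => (∑ k ∈ s, f k σ * g k τ) / c) =
      (∑ k ∈ s, gibbs β H₁ (f k) * gibbs β H₂ (g k)) / c := by
  have hZ : ∑ σ : Fin N → Bool, ∑ τ : Fin N → Bool, Real.exp (β * H₁ σ + β * H₂ τ) =
      (∑ σ, Real.exp (β * H₁ σ)) * ∑ τ, Real.exp (β * H₂ τ) := by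
    simp only [Real.exp_add, Finset.sum_mul_sum]
  have hnum : ∑ σ : Fin N → Bool, ∑ τ : Fin N → Bool,
      (∑ k ∈ s, f k σ * g k τ) / c * Real.exp (β * H₁ σ + β * H₂ τ) =
      (∑ k ∈ s, (∑ σ, f k σ * Real.exp (β * H₁ σ)) * ∑ τ, g k τ * Real.exp (β * H₂ τ)) / c := by
    simp only [Real.exp_add, div_mul_eq_mul_div, ← Finset.sum_div, Finset.sum_mul, Finset.mul_sum]
    congr 1
    symm
    rw [Finset.sum_comm]
    conv_rhs => rw [Finset.sum_comm]
    refine Finset.sum_congr rfl fun σ _ => ?_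
    rw [Finset.sum_comm]
    refine Finset.sum_congr rfl fun τ _ => Finset.sum_congr rfl fun k _ => ?_
    ring
  rw [gibbs2, hZ, hnum, div_right_comm, Finset.sum_div]
  simp only [gibbs, div_mul_div_comm]

lemma gibbs2_overlap_sq (Edges : Finset (Finset (Fin N))) (ρ : ℕ → ℝ → ℝ) (β : ℝ)
    (J J' : Finset (Fin N) → ℝ) :
    gibbs2 β (ham Edges ρ J) (ham Edges ρ J') (fun σ τ => overlap σ τ ^ 2) =
      (∑ p : Fin N × Fin N, corr Edges ρ β p.1 p.2 J * corr Edges ρ β p.1 p.2 J') / N ^ 2 := by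
  have h : ∀ σ τ : Fin N → Bool, overlap σ τ ^ 2 =
      (∑ p : Fin N × Fin N, (spin (σ p.1) * spin (σ p.2)) * (spin (τ p.1) * spin (τ p.2))) /
        (N : ℝ) ^ 2 := by
    intro σ τ
    rw [overlap, div_pow, sq (∑ i, _), Finset.sum_mul_sum, Fintype.sum_prod_type]
    congr 1
    refine Finset.sum_congr rfl fun i _ => Finset.sum_congr rfl fun j _ => ?_
    ring
  simp only [h]
  exact gibbs2_sum_mul (Finset.univ : Finset (Fin N × Fin N)) β ((N : ℝ) ^ 2) (ham Edges ρ J)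
    (ham Edges ρ J') (fun p σ => spin (σ p.1) * spin (σ p.2))
    (fun p τ => spin (τ p.1) * spin (τ p.2))

/-- If distant two-point functions decorrelate, the expected squared overlap is bounded by the
maximal relative size of a ball plus the decorrelation bound. -/
lemma integral_gibbs2_overlap_sq_le (hN : 1 ≤ N) (Edges : Finset (Finset (Fin N)))
    {ρ : ℕ → ℝ → ℝ} (hρmeas : ∀ p, Measurable (ρ p)) (β : ℝ) (r : ℕ) {Ω : Type*}
    [MeasurableSpace Ω] {P : Measure Ω} [IsProbabilityMeasure P]
    {J J' : Ω → Finset (Fin N) → ℝ} (hJ : Measurable J) (hJ' : Measurable J') {D : ℝ}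
    (hD : 0 ≤ D) (hfar : ∀ i j, ¬ hdist Edges i j ≤ (r : ℕ∞) →
      ∫ ω, corr Edges ρ β i j (J ω) * corr Edges ρ β i j (J' ω) ∂P ≤ D) :
    ∫ ω, gibbs2 β (ham Edges ρ (J ω)) (ham Edges ρ (J' ω)) (fun σ τ => overlap σ τ ^ 2) ∂P ≤
      ((Finset.univ.sup fun i : Fin N => (hball Edges i r).card : ℕ) : ℝ) / N + D := by
  set M := Finset.univ.sup fun i : Fin N => (hball Edges i r).card with hM
  have hN0 : (0 : ℝ) < N := by exact_mod_cast hN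
  simp_rw [gibbs2_overlap_sq]
  have hbd : ∀ i j ω, |corr Edges ρ β i j (J ω) * corr Edges ρ β i j (J' ω)| ≤ 1 := fun i j ω =>
    abs_mul_le_one (abs_corr_le_one _ _ _ _ _ _) (abs_corr_le_one _ _ _ _ _ _)
  rw [integral_div, integral_finsetSum _ fun p _ => integrable_of_abs_le_one
    (((measurable_corr Edges hρmeas β p.1 p.2).comp hJ).mul
      ((measurable_corr Edges hρmeas β p.1 p.2).comp hJ')) (hbd p.1 p.2),
    Fintype.sum_prod_type, div_le_iff₀ (by positivity)]
  have hrow : ∀ i : Fin N, ∑ j, ∫ ω, corr Edges ρ β i j (J ω) * corr Edges ρ β i j (J' ω) ∂P ≤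
      M + N * D := by
    intro i
    calc ∑ j, ∫ ω, corr Edges ρ β i j (J ω) * corr Edges ρ β i j (J' ω) ∂P
        ≤ ∑ j, ((if j ∈ hball Edges i r then 1 else 0) + D) := by
          refine Finset.sum_le_sum fun j _ => ?_
          split_ifs with hj
          · linarith [(abs_le.1 (abs_integral_le_one (P := P) (hbd i j))).2]
          · rw [zero_add]
            exact hfar i j (by simpa [hball] using hj)
      _ = (hball Edges i r).card + N * D := by
          rw [Finset.sum_add_distrib]
          simp
      _ ≤ M + N * D := by
          have : (hball Edges i r).card ≤ M :=
            Finset.le_sup (f := fun i : Fin N => (hball Edges i r).card) (Finset.mem_univ i)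
          have : ((hball Edges i r).card : ℝ) ≤ M := by exact_mod_cast this
          linarith
  refine (Finset.sum_le_card_nsmul _ _ _ fun i _ => hrow i).trans_eq ?_
  rw [Finset.card_univ, Fintype.card_fin, nsmul_eq_mul]
  field_simp

/-- In the mixed even `p`-spin short-range model, for both perturbations,
`E⟨R(σ,τ)²⟩_t ≤ N⁻¹ max_i |B_r(i)| + e^{-tr}` for every `r`. -/
theorem stmt6
    (N Δ : ℕ) (hN : 1 ≤ N) (hΔ : 2 ≤ Δ)
    (Edges : Finset (Finset (Fin N)))
    (hcard : ∀ e ∈ Edges, 2 ≤ e.card ∧ e.card ≤ Δ)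
    (heven : ∀ e ∈ Edges, Even e.card)
    (ρ : ℕ → ℝ → ℝ) (hρmeas : ∀ p, Measurable (ρ p))
    (hρodd : ∀ p x, ρ p (-x) = - ρ p x)
    (t β : ℝ) (ht : 0 ≤ t) (hβ : 0 ≤ β) (r : ℕ) :
    contExp Edges ρ β t (fun σ τ => overlap σ τ ^ 2)
        ≤ ((Finset.univ.sup fun i : Fin N => (hball Edges i r).card : ℕ) : ℝ) / N +
            Real.exp (-(t * r)) ∧
      discExp Edges ρ β t (fun σ τ => overlap σ τ ^ 2)
        ≤ ((Finset.univ.sup fun i : Fin N => (hball Edges i r).card : ℕ) : ℝ) / N +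
            Real.exp (-(t * r)) := by
  have hPprob : IsProbabilityMeasure (pairGauss (Finset (Fin N))) := by
    rw [pairGauss]; infer_instance
  have hBprob := isProbabilityMeasure_berBool (Real.exp_pos (-t)).le
    (Real.exp_le_one_iff.2 (by linarith))
  have hTprob : IsProbabilityMeasure (tripleGaussBer (Finset (Fin N)) (Real.exp (-t))) := by
    rw [tripleGaussBer]; infer_instance
  have hcont : Measurable fun ω : (Finset (Fin N) → ℝ) × (Finset (Fin N) → ℝ) =>
      contPerturb t ω.1 ω.2 := by
    unfold contPerturb
    fun_prop
  refine ⟨integral_gibbs2_overlap_sq_le hN Edges hρmeas β r measurable_fst hcont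
      (Real.exp_pos _).le fun i j hij => ?_,
    integral_gibbs2_overlap_sq_le hN Edges hρmeas β r measurable_fst measurable_discPerturb
      (Real.exp_pos _).le fun i j hij => ?_⟩
  · exact integral_mul_contPerturb_le (measurable_corr Edges hρmeas β i j)
      (abs_corr_le_one Edges ρ β i j) (oddOutside_corr Edges heven ρ hρodd β i j r hij) ht
  · exact integral_mul_discPerturb_le (measurable_corr Edges hρmeas β i j)
      (abs_corr_le_one Edges ρ β i j) (oddOutside_corr Edges heven ρ hρodd β i j r hij) ht
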